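/- (Separation, Theorem 1.18 part.) Let d = n−1 and let E ⊂ R^n be a nonempty compact connected set such that γ(x,r) ≤ ε for all x ∈ E and 0 < r ≤ r_0, with ε sufficiently small depending on n. Then R^n \ E has exactly two connected components. -/

import Mathlib

open Metric Set

/-- The normalized local Hausdorff distance. -/
noncomputable def locDist {n : ℕ} (x : EuclideanSpace ℝ (Fin n)) (r : ℝ)
    (A B : Set (EuclideanSpace ℝ (Fin n))) : ℝ :=
  r⁻¹ * sSup ((fun y => Metric.infDist y B) '' (A ∩ Metric.closedBall x r))
    + r⁻¹ * sSup ((fun y => Metric.infDist y A) '' (B ∩ Metric.closedBall x r))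

open scoped Topology

section Flat

variable {X : Type*} [NormedAddCommGroup X] [InnerProductSpace ℝ X]

/-- The hyperplane through `x` with unit normal `v` approximates `E` in the ball of centre `x`
and radius `r`, up to an error `r / 10000`. -/
structure IsFlatNormal (E : Set X) (x : X) (r : ℝ) (v : X) : Prop where
  norm_eq_one : ‖v‖ = 1
  abs_inner_le : ∀ y ∈ E, dist y x ≤ r → |inner ℝ (y - x) v| ≤ r / 10000
  exists_dist_le : ∀ y, dist y x ≤ r → inner ℝ (y - x) v = 0 → ∃ z ∈ E, dist y z ≤ r / 10000

/-- The part of the ball of centre `x` and radius `r / 4` lying well above the hyperplane through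
`x` with normal `v`. -/
def upperSide (x v : X) (r : ℝ) : Set X :=
  {y | dist y x < r / 4 ∧ r / 16 < inner ℝ (y - x) v}

theorem isOpen_upperSide (x v : X) (r : ℝ) : IsOpen (upperSide x v r) := by
  have h1 : IsOpen {y : X | dist y x < r / 4} := isOpen_lt (by fun_prop) (by fun_prop)
  have h2 : IsOpen {y : X | r / 16 < inner ℝ (y - x) v} := isOpen_lt (by fun_prop) (by fun_prop)
  exact h1.inter h2

theorem convex_upperSide (x v : X) (r : ℝ) : Convex ℝ (upperSide x v r) := by
  refine (convex_ball x (r / 4)).inter (?_ : Convex ℝ {y | r / 16 < inner ℝ (y - x) v})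
  have : {y : X | r / 16 < inner ℝ (y - x) v} = {y | r / 16 + inner ℝ x v < innerSL ℝ v y} := by
    ext y
    simp only [mem_ofPred_eq, inner_sub_left, innerSL_apply_apply, real_inner_comm y v]
    constructor <;> intro h <;> linarith
  rw [this]
  exact convex_halfSpace_gt (innerSL ℝ v).isLinear _

theorem inner_le_add_norm_sub (y v w : X) : inner ℝ y v ≤ inner ℝ y w + ‖y‖ * ‖v - w‖ := by
  have h := real_inner_le_norm y (v - w)
  rw [inner_sub_right] at h
  linarith

theorem add_smul_mem_upperSide {x v : X} {r : ℝ} (hr : 0 < r) (hv : ‖v‖ = 1) :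
    x + (r / 8) • v ∈ upperSide x v r := by
  constructor
  · rw [dist_eq_norm, add_sub_cancel_left, norm_smul, hv, Real.norm_of_nonneg (by positivity)]
    linarith
  · rw [add_sub_cancel_left, real_inner_smul_left, real_inner_self_eq_norm_sq, hv]
    linarith

theorem upperSide_inter_half_nonempty {x v w : X} {r : ℝ} (hr : 0 < r) (hv : ‖v‖ = 1)
    (h : ‖v - w‖ ≤ 1 / 10) :
    (upperSide x v r ∩ upperSide x w (r / 2)).Nonempty := by
  have h1 : ‖(r / 10) • v‖ = r / 10 := by
    rw [norm_smul, hv, Real.norm_of_nonneg (by positivity), mul_one]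
  have h2 : inner ℝ ((r / 10) • v) v = r / 10 := by
    rw [real_inner_smul_left, real_inner_self_eq_norm_sq, hv]; ring
  have h3 := inner_le_add_norm_sub ((r / 10) • v) v w
  rw [h1, h2] at h3
  refine ⟨x + (r / 10) • v, ⟨?_, ?_⟩, ?_, ?_⟩
  · rw [dist_eq_norm, add_sub_cancel_left, h1]; linarith
  · rw [add_sub_cancel_left, h2]; linarith
  · rw [dist_eq_norm, add_sub_cancel_left, h1]; linarith
  · rw [add_sub_cancel_left]; nlinarith

theorem upperSide_inter_nonempty {x x' v w : X} {r : ℝ} (hr : 0 < r) (hv : ‖v‖ = 1)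
    (hw : ‖w‖ = 1) (h : ‖v - w‖ ≤ 1 / 10) (hx : dist x x' ≤ r / 32) :
    (upperSide x v r ∩ upperSide x' w r).Nonempty := by
  refine ⟨x + (r / 8) • v, add_smul_mem_upperSide hr hv, ?_⟩
  have h1 : ‖(r / 8) • v‖ = r / 8 := by
    rw [norm_smul, hv, Real.norm_of_nonneg (by positivity), mul_one]
  have h2 : inner ℝ ((r / 8) • v) v = r / 8 := by
    rw [real_inner_smul_left, real_inner_self_eq_norm_sq, hv]; ring
  have h3 := inner_le_add_norm_sub ((r / 8) • v) v w
  rw [h1, h2] at h3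
  have h4 : x + (r / 8) • v - x' = (r / 8) • v + (x - x') := by abel
  rw [dist_eq_norm] at hx
  have h5 := (abs_le.1 (abs_real_inner_le_norm (x - x') w)).1
  rw [hw, mul_one] at h5
  constructor
  · rw [dist_eq_norm, h4]
    linarith [norm_add_le ((r / 8) • v) (x - x')]
  · rw [h4, inner_add_left]
    nlinarith

namespace IsFlatNormal

variable {E : Set X} {x x' v v' : X} {r r' : ℝ}

protected theorem neg (h : IsFlatNormal E x r v) : IsFlatNormal E x r (-v) where
  norm_eq_one := by rw [norm_neg, h.norm_eq_one]
  abs_inner_le y hy hd := by rw [inner_neg_right, abs_neg]; exact h.abs_inner_le y hy hd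
  exists_dist_le y hd hy := by
    rw [inner_neg_right, neg_eq_zero] at hy; exact h.exists_dist_le y hd hy

/-- Normals at comparable scales and nearby points agree up to sign. -/
theorem norm_sub_le_or_norm_add_le (h : IsFlatNormal E x r v) (h' : IsFlatNormal E x' r' v')
    (hx' : x' ∈ E) (hr' : 0 < r') (hle : r' ≤ r) (hle' : r ≤ 4 * r')
    (hd : dist x' x ≤ r / 2) : ‖v - v'‖ ≤ 1 / 10 ∨ ‖v + v'‖ ≤ 1 / 10 := by
  have hvv : inner ℝ v v = (1 : ℝ) := by rw [real_inner_self_eq_norm_sq, h.norm_eq_one]; norm_num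
  have hvv' : inner ℝ v' v' = (1 : ℝ) := by
    rw [real_inner_self_eq_norm_sq, h'.norm_eq_one]; norm_num
  set c : ℝ := inner ℝ v v' with hc
  have hc' : inner ℝ v' v = c := real_inner_comm _ _
  set u := v - c • v' with hu
  have huv' : inner ℝ u v' = (0 : ℝ) := by
    rw [hu, inner_sub_left, real_inner_smul_left, hvv', ← hc]; ring
  have huv : inner ℝ u v = 1 - c ^ 2 := by
    rw [hu, inner_sub_left, real_inner_smul_left, hvv, hc']; ring
  have huu : ‖u‖ ^ 2 = 1 - c ^ 2 := by
    rw [← real_inner_self_eq_norm_sq]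
    nth_rw 2 [hu]
    rw [inner_sub_right, real_inner_smul_right, huv, huv']; ring
  have hu1 : ‖u‖ ≤ 1 := by nlinarith [norm_nonneg u, sq_nonneg c]
  have hnorm : ‖(r' / 4) • u‖ ≤ r' / 4 := by
    rw [norm_smul, Real.norm_of_nonneg (by positivity)]
    nlinarith [norm_nonneg u]
  obtain ⟨z, hz, hyz⟩ := h'.exists_dist_le (x' + (r' / 4) • u)
    (by rw [dist_eq_norm, add_sub_cancel_left]; linarith)
    (by rw [add_sub_cancel_left, real_inner_smul_left, huv', mul_zero])
  have hzx' : dist z x' ≤ r' / 10000 + r' / 4 := by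
    have : dist (x' + (r' / 4) • u) x' ≤ r' / 4 := by
      rw [dist_eq_norm, add_sub_cancel_left]; exact hnorm
    linarith [dist_triangle_left z x' (x' + (r' / 4) • u)]
  have h1 := abs_le.1 (h.abs_inner_le z hz (by linarith [dist_triangle z x' x]))
  have h2 := abs_le.1 (h.abs_inner_le x' hx' (by linarith [dist_nonneg (x := x') (y := x)]))
  have h3 := abs_real_inner_le_norm (x' + (r' / 4) • u - z) v
  rw [h.norm_eq_one, mul_one, ← dist_eq_norm] at h3
  have h3 := abs_le.1 (h3.trans hyz)
  have h4 : x' + (r' / 4) • u - z = (r' / 4) • u + (x' - x) - (z - x) := by abel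
  rw [h4, inner_sub_left, inner_add_left, real_inner_smul_left, huv] at h3
  have h5 : 1 - c ^ 2 ≤ 36 / 10000 := by
    by_contra! hcon
    nlinarith
  have e1 : ‖v - v'‖ ^ 2 = 2 - 2 * c := by
    rw [norm_sub_sq_real, h.norm_eq_one, h'.norm_eq_one]; ring
  have e2 : ‖v + v'‖ ^ 2 = 2 + 2 * c := by
    rw [norm_add_sq_real, h.norm_eq_one, h'.norm_eq_one]; ring
  have hc1 : c ^ 2 ≤ 1 := by nlinarith [sq_nonneg ‖u‖]
  have hc2 := abs_le.1 ((sq_le_one_iff_abs_le_one c).1 hc1)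
  rcases le_total 0 c with h0 | h0
  · left
    by_contra! hcon
    nlinarith [norm_nonneg (v - v')]
  · right
    by_contra! hcon
    nlinarith [norm_nonneg (v + v')]

theorem norm_sub_le_of_norm_sub_lt_one (h : IsFlatNormal E x r v) (h' : IsFlatNormal E x' r' v')
    (hx' : x' ∈ E) (hr' : 0 < r') (hle : r' ≤ r) (hle' : r ≤ 4 * r')
    (hd : dist x' x ≤ r / 2) (hlt : ‖v - v'‖ < 1) : ‖v - v'‖ ≤ 1 / 10 := by
  refine (h.norm_sub_le_or_norm_add_le h' hx' hr' hle hle' hd).resolve_right fun hadd => ?_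
  have h2 : ‖(2 : ℝ) • v‖ = 2 := by rw [norm_smul, h.norm_eq_one]; norm_num
  have h3 : (2 : ℝ) • v = (v - v') + (v + v') := by rw [two_smul]; abel
  have := norm_add_le (v - v') (v + v')
  rw [← h3, h2] at this
  linarith

theorem le_infDist_of_mem_upperSide (h : IsFlatNormal E x r v) (hne : E.Nonempty) (hr : 0 < r)
    {y : X}
    (hy : y ∈ upperSide x v r) : r / 32 ≤ infDist y E := by
  refine (le_infDist hne).2 fun z hz => ?_
  by_contra! hcon
  have h1 := (abs_le.1 (h.abs_inner_le z hz
    (by linarith [dist_triangle_left z x y, hy.1]))).2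
  have h2 := real_inner_le_norm (y - z) v
  rw [h.norm_eq_one, mul_one, ← dist_eq_norm] at h2
  have h3 : y - x = (y - z) + (z - x) := by abel
  have h4 := hy.2
  rw [h3, inner_add_left] at h4
  linarith

theorem notMem_of_mem_upperSide (h : IsFlatNormal E x r v) (hr : 0 < r) {y : X}
    (hy : y ∈ upperSide x v r) : y ∉ E := fun hyE => by
  have := h.le_infDist_of_mem_upperSide ⟨y, hyE⟩ hr hy
  rw [infDist_zero_of_mem hyE] at this
  linarith

theorem mem_upperSide_or (h : IsFlatNormal E x r v) {y : X}
    (hyx : dist y x = infDist y E) (h1 : r / 10 ≤ dist y x) (h2 : dist y x < r / 4) :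
    y ∈ upperSide x v r ∨ y ∈ upperSide x (-v) r := by
  set t : ℝ := inner ℝ (y - x) v with ht
  have hvv : inner ℝ v v = (1 : ℝ) := by rw [real_inner_self_eq_norm_sq, h.norm_eq_one]; norm_num
  have e : y - t • v - x = (y - x) - t • v := by abel
  have hin : inner ℝ (y - t • v - x) v = (0 : ℝ) := by
    rw [e, inner_sub_left, real_inner_smul_left, hvv, ← ht]; ring
  have htv : ‖t • v‖ = |t| := by rw [norm_smul, h.norm_eq_one, mul_one, Real.norm_eq_abs]
  have htle : |t| ≤ dist y x := by
    have := abs_real_inner_le_norm (y - x) v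
    rwa [h.norm_eq_one, mul_one, ← dist_eq_norm] at this
  obtain ⟨z, hz, hyz⟩ := h.exists_dist_le (y - t • v)
    (by rw [dist_eq_norm, e]
        have := norm_sub_le (y - x) (t • v)
        rw [htv, ← dist_eq_norm y x] at this
        linarith) hin
  have h3 : infDist y E ≤ dist y z := infDist_le_dist_of_mem hz
  have h4 : dist y (y - t • v) = |t| := by rw [dist_eq_norm, sub_sub_cancel, htv]
  have h5 := dist_triangle y (y - t • v) z
  have h6 : r / 16 < |t| := by linarith
  rcases lt_abs.1 h6 with h7 | h7
  · exact .inl ⟨h2, h7⟩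
  · exact .inr ⟨h2, by rw [inner_neg_right]; exact h7⟩

end IsFlatNormal

end Flat

section Sides

variable {X : Type*} [NormedAddCommGroup X] [InnerProductSpace ℝ X]

/-- The dyadic scales below `r₀`. -/
noncomputable def dyadicScale (r₀ : ℝ) (k : ℕ) : ℝ := r₀ / 2 ^ k

/-- A choice of unit normals to a compact set `E` at all its points and all dyadic scales. -/
structure IsFlatSystem (E : Set X) (r₀ : ℝ) (N : X → ℕ → X) : Prop where
  isCompact : IsCompact E
  pos : 0 < r₀
  isFlatNormal : ∀ x ∈ E, ∀ k, IsFlatNormal E x (dyadicScale r₀ k) (N x k)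

/-- Near `z`, the function `f` is locally constant off `E` and separates the two sides of `E`. -/
def SeparatesAt (E : Set X) (r₀ : ℝ) (N : X → ℕ → X) (f : X → Bool) (z : X) : Prop :=
  (z ∉ E → ContinuousAt f z) ∧
    (z ∈ E → ∃ K, ∀ x ∈ E, dist x z ≤ dyadicScale r₀ K → ∀ k ≥ K,
      ∀ y ∈ upperSide x (N x k) (dyadicScale r₀ k),
        ∀ y' ∈ upperSide x (-N x k) (dyadicScale r₀ k), f y ≠ f y')

theorem dyadicScale_zero (r₀ : ℝ) : dyadicScale r₀ 0 = r₀ := by simp [dyadicScale]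

theorem dyadicScale_pos {r₀ : ℝ} (h : 0 < r₀) (k : ℕ) : 0 < dyadicScale r₀ k := by
  unfold dyadicScale; positivity

theorem dyadicScale_succ (r₀ : ℝ) (k : ℕ) : dyadicScale r₀ (k + 1) = dyadicScale r₀ k / 2 := by
  unfold dyadicScale; rw [pow_succ, div_div]

theorem dyadicScale_antitone {r₀ : ℝ} (h : 0 < r₀) : Antitone (dyadicScale r₀) :=
  antitone_nat_of_succ_le fun k => by
    rw [dyadicScale_succ]; linarith [dyadicScale_pos h k]

theorem exists_dyadicScale_lt {r₀ δ : ℝ} (h : 0 < r₀) (hδ : 0 < δ) (K : ℕ) :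
    ∃ k ≥ K, dyadicScale r₀ k < δ := by
  obtain ⟨n, hn⟩ := exists_pow_lt_of_lt_one (div_pos hδ h) (by norm_num : (1 / 2 : ℝ) < 1)
  refine ⟨max n K, le_max_right _ _, (dyadicScale_antitone h (le_max_left n K)).trans_lt ?_⟩
  rw [lt_div_iff₀ h, one_div, inv_pow] at hn
  unfold dyadicScale
  rwa [div_eq_inv_mul]

theorem exists_dyadicScale_near {r₀ δ : ℝ} {K : ℕ} (h : 0 < r₀) (hδ : 0 < δ)
    (hK : δ ≤ dyadicScale r₀ K / 5) :
    ∃ k ≥ K, dyadicScale r₀ k / 10 < δ ∧ δ ≤ dyadicScale r₀ k / 5 := by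
  have hp := dyadicScale_pos h K
  obtain ⟨j, h1, h2⟩ := exists_nat_pow_near_of_lt_one
    (x := 5 * δ / dyadicScale r₀ K) (y := (1 / 2 : ℝ)) (by positivity)
    (by rw [div_le_one hp]; linarith) (by norm_num) (by norm_num)
  have e : dyadicScale r₀ (K + j) = (1 / 2) ^ j * dyadicScale r₀ K := by
    unfold dyadicScale
    rw [pow_add, one_div, inv_pow]
    field_simp
  refine ⟨K + j, by omega, ?_, ?_⟩
  · rw [lt_div_iff₀ hp, pow_succ] at h1
    rw [e]; linarith
  · rw [div_le_iff₀ hp] at h2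
    rw [e]; linarith

variable {E : Set X} {r₀ : ℝ} {N : X → ℕ → X} {f g : X → Bool} {z : X}

theorem upperSide_subset_ball {x v : X} {r s : ℝ} (hr : 0 < r) (h : r ≤ s) :
    upperSide x v r ⊆ ball x s := fun y hy => by
  rw [mem_ball]; linarith [hy.1]

namespace SeparatesAt

protected theorem not (h : SeparatesAt E r₀ N f z) : SeparatesAt E r₀ N (fun y => !f y) z := by
  refine ⟨fun hz => (continuous_of_discreteTopology (f := Bool.not)).continuousAt.comp (h.1 hz),
    fun hz => ?_⟩
  obtain ⟨K, hK⟩ := h.2 hz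
  exact ⟨K, fun x hx hd k hk y hy y' hy' => by simpa using hK x hx hd k hk y hy y' hy'⟩

end SeparatesAt

namespace IsFlatSystem

theorem scale_pos (hN : IsFlatSystem E r₀ N) (k : ℕ) : 0 < dyadicScale r₀ k :=
  dyadicScale_pos hN.pos k

theorem isFlatNormal_of (hN : IsFlatSystem E r₀ N) {x v : X} {k : ℕ} (hx : x ∈ E)
    (hv : v = N x k ∨ v = -N x k) :
    IsFlatNormal E x (dyadicScale r₀ k) v := by
  rcases hv with rfl | rfl
  · exact hN.isFlatNormal x hx k
  · exact (hN.isFlatNormal x hx k).neg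

end IsFlatSystem
end Sides

section Uniqueness

variable {X : Type*} [NormedAddCommGroup X] [InnerProductSpace ℝ X]
variable {E : Set X} {r₀ : ℝ} {N : X → ℕ → X} {f f' g : X → Bool} {z : X} {V : Set X}

namespace IsFlatSystem

theorem notMem_of_mem_upperSide (hN : IsFlatSystem E r₀ N) {x v y : X} {k : ℕ} (hx : x ∈ E)
    (hv : v = N x k ∨ v = -N x k)
    (hy : y ∈ upperSide x v (dyadicScale r₀ k)) : y ∉ E :=
  (hN.isFlatNormal_of hx hv).notMem_of_mem_upperSide (hN.scale_pos k) hy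

theorem separatesAt_congr (hN : IsFlatSystem E r₀ N) (h : SeparatesAt E r₀ N f z)
    (he : ∀ᶠ y in 𝓝 z, y ∉ E → f' y = f y) : SeparatesAt E r₀ N f' z := by
  refine ⟨fun hz => (h.1 hz).congr ?_, fun hz => ?_⟩
  · filter_upwards [he, hN.isCompact.isClosed.isOpen_compl.mem_nhds hz] with y h1 h2
    exact (h1 h2).symm
  · obtain ⟨K, hK⟩ := h.2 hz
    obtain ⟨δ, hδ, hball⟩ := Metric.eventually_nhds_iff.1 he
    obtain ⟨L, hLK, hL⟩ := exists_dyadicScale_lt hN.pos (half_pos hδ) K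
    have hmono := dyadicScale_antitone hN.pos
    refine ⟨L, fun x hx hd k hk y hy y' hy' => ?_⟩
    have key : ∀ w v, (v = N x k ∨ v = -N x k) → w ∈ upperSide x v (dyadicScale r₀ k) →
        f' w = f w := fun w v hv hw => by
      refine hball ?_ (hN.notMem_of_mem_upperSide hx hv hw)
      linarith [hw.1, dist_triangle w x z, hmono hk, hN.scale_pos k]
    rw [key y _ (.inl rfl) hy, key y' _ (.inr rfl) hy']
    exact hK x hx (hd.trans (hmono hLK)) k (hLK.trans hk) y hy y' hy'

theorem exists_signed_normal (hN : IsFlatSystem E r₀ N) {x x' v : X} {k k' : ℕ} (hx : x ∈ E)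
    (hx' : x' ∈ E)
    (hv : v = N x k ∨ v = -N x k) (hk : k ≤ k') (hk' : k' ≤ k + 2)
    (hd : dist x' x ≤ dyadicScale r₀ k / 2) :
    ∃ w, (w = N x' k' ∨ w = -N x' k') ∧ ‖v - w‖ ≤ 1 / 10 := by
  have h4 : dyadicScale r₀ k ≤ 4 * dyadicScale r₀ k' := by
    have := dyadicScale_antitone hN.pos hk'
    rw [dyadicScale_succ, dyadicScale_succ] at this
    linarith
  rcases (hN.isFlatNormal_of hx hv).norm_sub_le_or_norm_add_le (hN.isFlatNormal x' hx' k') hx'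
    (hN.scale_pos k') (dyadicScale_antitone hN.pos hk) h4 hd with h | h
  · exact ⟨_, .inl rfl, h⟩
  · exact ⟨_, .inr rfl, by rwa [sub_neg_eq_add]⟩

/-- A locally constant function is constant on the sides which lie in its domain. -/
theorem eq_of_mem_upperSide (hN : IsFlatSystem E r₀ N) (hf : ∀ y ∈ V, SeparatesAt E r₀ N f y)
    (hg : ContinuousOn g {y | y ∈ V ∧ y ∉ E ∧ f y = true}) {x v y p : X} {k : ℕ} (hx : x ∈ E)
    (hv : v = N x k ∨ v = -N x k) (hV : ball x (dyadicScale r₀ k) ⊆ V)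
    (hy : y ∈ upperSide x v (dyadicScale r₀ k)) (hp : p ∈ upperSide x v (dyadicScale r₀ k))
    (hfp : f p = true) : f y = true ∧ g y = g p := by
  have hpre := (convex_upperSide x v (dyadicScale r₀ k)).isPreconnected
  have hsub := (upperSide_subset_ball (v := v) (hN.scale_pos k) le_rfl).trans hV
  have hfc : ContinuousOn f (upperSide x v (dyadicScale r₀ k)) := fun w hw =>
    ((hf w (hsub hw)).1 (hN.notMem_of_mem_upperSide hx hv hw)).continuousWithinAt
  have hft : ∀ w ∈ upperSide x v (dyadicScale r₀ k), f w = true := fun w hw =>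
    (hpre.constant hfc hw hp).trans hfp
  refine ⟨hft y hy, hpre.constant (hg.mono fun w hw => ?_) hy hp⟩
  exact ⟨hsub hw, hN.notMem_of_mem_upperSide hx hv hw, hft w hw⟩

theorem exists_mem_upperSide_of_le (hN : IsFlatSystem E r₀ N) (hf : ∀ y ∈ V, SeparatesAt E r₀ N f y)
    (hg : ContinuousOn g {y | y ∈ V ∧ y ∉ E ∧ f y = true}) {x : X} {K k : ℕ} (hx : x ∈ E)
    (hKk : K ≤ k) (hV : ball x (dyadicScale r₀ K) ⊆ V) {y v : X} (hv : v = N x k ∨ v = -N x k)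
    (hy : y ∈ upperSide x v (dyadicScale r₀ k)) (hfy : f y = true) :
    ∃ p w, (w = N x K ∨ w = -N x K) ∧ p ∈ upperSide x w (dyadicScale r₀ K) ∧
      f p = true ∧ g p = g y := by
  induction k, hKk using Nat.le_induction generalizing y v with
  | base => exact ⟨y, v, hv, hy, hfy, rfl⟩
  | succ k hKk ih =>
    have hpos := hN.scale_pos k
    obtain ⟨w, hw, hvw⟩ : ∃ w, (w = N x k ∨ w = -N x k) ∧ ‖w - v‖ ≤ 1 / 10 := by
      obtain ⟨u, hu, huv⟩ := hN.exists_signed_normal (k := k) (k' := k + 1) hx hx (.inl rfl)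
        (by omega) (by omega) (by rw [dist_self]; linarith)
      by_cases h : u = v
      · exact ⟨_, .inl rfl, h ▸ huv⟩
      · have : v = -u := by
          rcases hu with rfl | rfl <;> rcases hv with rfl | rfl <;> simp_all
        refine ⟨_, .inr rfl, ?_⟩
        rwa [this, neg_sub_neg, norm_sub_rev]
    obtain ⟨p, hp1, hp2⟩ := upperSide_inter_half_nonempty (x := x) hpos
      (hN.isFlatNormal_of hx hw).norm_eq_one hvw
    rw [← dyadicScale_succ] at hp2
    have hV' : ball x (dyadicScale r₀ (k + 1)) ⊆ V :=
      (ball_subset_ball (dyadicScale_antitone hN.pos (by omega))).trans hV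
    obtain ⟨hfp, hgp⟩ := hN.eq_of_mem_upperSide hf hg hx hv hV' hp2 hy hfy
    obtain ⟨q, u, hu, hq, hfq, hgq⟩ := ih hw hp1 hfp
    exact ⟨q, u, hu, hq, hfq, hgq.trans hgp⟩

theorem exists_mem_upperSide_eq (hN : IsFlatSystem E r₀ N) {k : ℕ} (hz : z ∈ E)
    (hsep : ∀ y ∈ upperSide z (N z k) (dyadicScale r₀ k),
      ∀ y' ∈ upperSide z (-N z k) (dyadicScale r₀ k), f y ≠ f y') (c : Bool) :
    ∃ v p, (v = N z k ∨ v = -N z k) ∧ p ∈ upperSide z v (dyadicScale r₀ k) ∧ f p = c := by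
  have hpos := hN.scale_pos k
  have h1 := add_smul_mem_upperSide (x := z) hpos
    (hN.isFlatNormal_of hz (v := N z k) (.inl rfl)).norm_eq_one
  have h2 := add_smul_mem_upperSide (x := z) hpos
    (hN.isFlatNormal_of hz (v := -N z k) (.inr rfl)).norm_eq_one
  have h3 := hsep _ h1 _ h2
  by_cases h : f (z + (dyadicScale r₀ k / 8) • N z k) = c
  · exact ⟨_, _, .inl rfl, h1, h⟩
  · refine ⟨_, _, .inr rfl, h2, ?_⟩
    revert h h3
    generalize f _ = a
    generalize f _ = b
    revert a b c
    decide

/-- A locally constant function on the positive side of `E` has a limit at each point of `E`. -/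
theorem exists_eventually_eq (hN : IsFlatSystem E r₀ N) (hf : ∀ y ∈ V, SeparatesAt E r₀ N f y)
    (hg : ContinuousOn g {y | y ∈ V ∧ y ∉ E ∧ f y = true}) (hV : V ∈ 𝓝 z) (hz : z ∈ E) :
    ∃ c, ∀ᶠ y in 𝓝 z, y ∉ E → f y = true → g y = c := by
  obtain ⟨δ, hδ, hball⟩ := Metric.mem_nhds_iff.1 hV
  obtain ⟨K₀, hK₀⟩ := (hf z (mem_of_mem_nhds hV)).2 hz
  obtain ⟨K, hKK, hK⟩ := exists_dyadicScale_lt hN.pos (half_pos hδ) K₀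
  have hpos := hN.scale_pos K
  have hVz : ball z (dyadicScale r₀ K) ⊆ V := (ball_subset_ball (by linarith)).trans hball
  have hsep := hK₀ z hz (by rw [dist_self]; exact (hN.scale_pos _).le) K hKK
  obtain ⟨v, p, hv, hp, hfp⟩ := hN.exists_mem_upperSide_eq hz hsep true
  refine ⟨g p, Metric.eventually_nhds_iff.2 ⟨dyadicScale r₀ K / 64, by positivity,
    fun y hyz hyE hfy => ?_⟩⟩
  obtain ⟨x, hx, hxy⟩ := hN.isCompact.exists_infDist_eq_dist ⟨z, hz⟩ y
  have hyx : dist y x ≤ dist y z := hxy ▸ infDist_le_dist_of_mem hz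
  have hxz : dist x z ≤ dyadicScale r₀ K / 32 := by linarith [dist_triangle_left x z y]
  have hVx : ball x (dyadicScale r₀ K) ⊆ V := by
    refine (ball_subset_ball' ?_).trans hball
    linarith
  obtain ⟨k, hk, hk1, hk2⟩ := exists_dyadicScale_near (δ := dist y x) (K := K) hN.pos
    (dist_pos.2 fun h => hyE (h ▸ hx)) (by linarith)
  obtain ⟨w, hw, hyw⟩ : ∃ w, (w = N x k ∨ w = -N x k) ∧
      y ∈ upperSide x w (dyadicScale r₀ k) := by
    rcases (hN.isFlatNormal x hx k).mem_upperSide_or hxy.symm hk1.le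
      (by linarith [hN.scale_pos k]) with h | h
    · exact ⟨_, .inl rfl, h⟩
    · exact ⟨_, .inr rfl, h⟩
  obtain ⟨q, u, hu, hq, hfq, hgq⟩ := hN.exists_mem_upperSide_of_le hf hg hx hk hVx hw hyw hfy
  obtain ⟨v', hv', huv'⟩ := hN.exists_signed_normal (k := K) (k' := K) hx hz hu le_rfl
    (by omega) (by rw [dist_comm]; linarith)
  obtain ⟨q', hq1, hq2⟩ := upperSide_inter_nonempty hpos (hN.isFlatNormal_of hx hu).norm_eq_one
    (hN.isFlatNormal_of hz hv').norm_eq_one huv' hxz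
  obtain ⟨hfq', hgq'⟩ := hN.eq_of_mem_upperSide hf hg hx hu hVx hq1 hq hfq
  have hvv : v' = v := by
    rcases hv with rfl | rfl <;> rcases hv' with rfl | rfl
    · rfl
    · exact absurd (hfp.trans hfq'.symm) (hsep _ hp _ hq2)
    · exact absurd (hfq'.trans hfp.symm) (hsep _ hq2 _ hp)
    · rfl
  subst hvv
  obtain ⟨-, h⟩ := hN.eq_of_mem_upperSide hf hg hz hv hVz hp hq2 hfq'
  rw [h, hgq', hgq]

/-- A function separating the sides of `E` takes both values near each point of `E`. -/
theorem frequently_eq (hN : IsFlatSystem E r₀ N) (hf : SeparatesAt E r₀ N f z) (hz : z ∈ E)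
    (c : Bool) :
    ∃ᶠ y in 𝓝 z, y ∉ E ∧ f y = c := by
  rw [Filter.frequently_iff]
  intro U hU
  obtain ⟨δ, hδ, hball⟩ := Metric.mem_nhds_iff.1 hU
  obtain ⟨K₀, hK₀⟩ := hf.2 hz
  obtain ⟨K, hKK, hK⟩ := exists_dyadicScale_lt hN.pos hδ K₀
  obtain ⟨v, p, hv, hp, hfp⟩ := hN.exists_mem_upperSide_eq hz
    (hK₀ z hz (by rw [dist_self]; exact (hN.scale_pos _).le) K hKK) c
  exact ⟨p, hball (upperSide_subset_ball (hN.scale_pos K) hK.le hp),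
    hN.notMem_of_mem_upperSide hz hv hp, hfp⟩

theorem exists_eventually_xor_eq (hN : IsFlatSystem E r₀ N) (hV : IsOpen V)
    (hf : ∀ y ∈ V, SeparatesAt E r₀ N f y)
    (hf' : ∀ y ∈ V, SeparatesAt E r₀ N f' y) (hz : z ∈ V) :
    ∃ c, ∀ᶠ y in 𝓝 z, y ∉ E → xor (f y) (f' y) = c := by
  by_cases hzE : z ∈ E
  · have hc : ∀ s : Set X, s ⊆ {y | y ∈ V ∧ y ∉ E} → ContinuousOn f' s := fun s hs w hw =>
      ((hf' w (hs hw).1).1 (hs hw).2).continuousWithinAt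
    obtain ⟨a, ha⟩ := hN.exists_eventually_eq hf (hc _ fun w hw => ⟨hw.1, hw.2.1⟩)
      (hV.mem_nhds hz) hzE
    obtain ⟨b, hb⟩ := hN.exists_eventually_eq (fun y hy => (hf y hy).not)
      (hc _ fun w hw => ⟨hw.1, hw.2.1⟩) (hV.mem_nhds hz) hzE
    have hab : a ≠ b := by
      rintro rfl
      obtain ⟨y, ⟨hy, hfy⟩, h1, h2⟩ :=
        ((hN.frequently_eq (hf' z hz) hzE (!a)).and_eventually (ha.and hb)).exists
      cases h : f y <;> simp_all
    refine ⟨xor true a, ?_⟩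
    filter_upwards [ha, hb] with y h1 h2 hy
    cases h : f y
    · have := h2 hy (by simp [h])
      rw [this]
      clear * - hab
      revert a b; decide
    · rw [h1 hy h]
  · refine ⟨xor (f z) (f' z), ?_⟩
    have h1 := (hf z hz).1 hzE
    have h2 := (hf' z hz).1 hzE
    rw [ContinuousAt, nhds_discrete Bool, Filter.tendsto_pure] at h1 h2
    filter_upwards [h1, h2] with y h1 h2 _
    rw [h1, h2]

/-- Two functions separating the sides of `E` agree up to a global sign. -/
theorem exists_xor_eq (hN : IsFlatSystem E r₀ N) (hV : IsOpen V) (hVc : IsPreconnected V)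
    (hf : ∀ y ∈ V, SeparatesAt E r₀ N f y) (hf' : ∀ y ∈ V, SeparatesAt E r₀ N f' y) :
    ∃ c, ∀ y ∈ V, y ∉ E → xor (f y) (f' y) = c := by
  have hfreq : ∀ z ∈ V, ∃ᶠ y in 𝓝 z, y ∉ E := fun z hz => by
    by_cases hzE : z ∈ E
    · exact (hN.frequently_eq (hf z hz) hzE true).mono fun _ h => h.1
    · exact Filter.Eventually.frequently (hN.isCompact.isClosed.isOpen_compl.mem_nhds hzE)
  choose! c hc using fun z (hz : z ∈ V) => hN.exists_eventually_xor_eq hV hf hf' hz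
  have hcc : ContinuousOn c V := fun z hz => by
    refine ContinuousAt.continuousWithinAt ?_
    rw [ContinuousAt, nhds_discrete Bool, Filter.tendsto_pure]
    filter_upwards [(hc z hz).eventually_nhds, hV.mem_nhds hz] with w hw hwV
    obtain ⟨y, hy, h1, h2⟩ := ((hfreq w hwV).and_eventually (hw.and (hc w hwV))).exists
    exact (h2 hy).symm.trans (h1 hy)
  have hval : ∀ y ∈ V, y ∉ E → xor (f y) (f' y) = c y := fun y hy hyE =>
    (hc y hy).self_of_nhds hyE
  rcases V.eq_empty_or_nonempty with rfl | ⟨p, hp⟩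
  · exact ⟨true, fun y hy => hy.elim⟩
  · exact ⟨c p, fun y hy hyE => (hval y hy hyE).trans (hVc.constant hcc hy hp)⟩

/-- Functions separating the sides of `E` on two open sets with connected intersection can be
glued together. -/
theorem exists_glue (hN : IsFlatSystem E r₀ N) {A B : Set X} (hA : IsOpen A) (hB : IsOpen B)
    (hAB : IsPreconnected (A ∩ B))
    (hf : ∀ y ∈ A, SeparatesAt E r₀ N f y) (hf' : ∀ y ∈ B, SeparatesAt E r₀ N f' y) :
    ∃ h : X → Bool, (∀ y ∈ A ∪ B, SeparatesAt E r₀ N h y) ∧ ∀ y ∈ A, h y = f y := by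
  classical
  obtain ⟨c, hc⟩ := hN.exists_xor_eq (hA.inter hB) hAB (fun y hy => hf y hy.1)
    (fun y hy => hf' y hy.2)
  refine ⟨fun y => if y ∈ A then f y else xor c (f' y), ?_, fun y hy => if_pos hy⟩
  rintro y (hy | hy)
  · refine hN.separatesAt_congr (hf y hy) ?_
    filter_upwards [hA.mem_nhds hy] with w hw _
    exact if_pos hw
  · have hxor : SeparatesAt E r₀ N (fun y => xor c (f' y)) y := by
      cases c
      · simpa using hf' y hy
      · simpa using (hf' y hy).not
    refine hN.separatesAt_congr hxor ?_
    filter_upwards [hB.mem_nhds hy] with w hw hwE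
    split_ifs with hwA
    · rw [← hc w ⟨hwA, hw⟩ hwE]; simp
    · rfl

end IsFlatSystem
end Uniqueness

section Existence

variable {X : Type*} [NormedAddCommGroup X] [InnerProductSpace ℝ X]
variable {E : Set X} {r₀ : ℝ} {N : X → ℕ → X} {f f' g : X → Bool} {z : X} {V : Set X}

namespace IsFlatSystem

/-- Signs of the normals at a point can be chosen coherently across all scales. -/
theorem exists_coherent_signs (hN : IsFlatSystem E r₀ N) {x x₀ : X} (hx : x ∈ E) (hx₀ : x₀ ∈ E)
    (hd : dist x x₀ ≤ r₀ / 2) :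
    ∃ m : ℕ → X, (∀ k, m k = N x k ∨ m k = -N x k) ∧ ‖N x₀ 0 - m 0‖ ≤ 1 / 10 ∧
      ∀ k, ‖m k - m (k + 1)‖ ≤ 1 / 10 := by
  obtain ⟨m₀, hm₀, hm₀'⟩ := hN.exists_signed_normal (k := 0) (k' := 0) hx₀ hx (.inl rfl) le_rfl
    (by omega) (by rwa [dyadicScale_zero])
  choose! c hc hc' using fun (k : ℕ) (v : X) (hv : v = N x k ∨ v = -N x k) =>
    hN.exists_signed_normal (k := k) (k' := k + 1) hx hx hv (by omega) (by omega)
      (by rw [dist_self]; linarith [hN.scale_pos k])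
  let m : ℕ → X := fun k => Nat.rec m₀ c k
  have hm : ∀ k, m k = N x k ∨ m k = -N x k := fun k => by
    induction k with
    | zero => exact hm₀
    | succ k ih => exact hc k _ ih
  exact ⟨m, hm, hm₀', fun k => hc' k _ (hm k)⟩

theorem false_of_mem_upperSide_neg (hN : IsFlatSystem E r₀ N) {x x' a b y : X} {k k' : ℕ}
    (hx : x ∈ E) (hx' : x' ∈ E)
    (ha : a = N x k ∨ a = -N x k) (hk : k ≤ k')
    (hab : dist x' x ≤ dyadicScale r₀ k / 2 → k' ≤ k + 2 → ‖a - b‖ ≤ 1 / 5)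
    (hy : y ∈ upperSide x a (dyadicScale r₀ k))
    (hy' : y ∈ upperSide x' (-b) (dyadicScale r₀ k')) : False := by
  have hfa := hN.isFlatNormal_of hx ha
  have hpos := hN.scale_pos k
  have hpos' := hN.scale_pos k'
  have hmono := dyadicScale_antitone hN.pos hk
  have h1 := hfa.le_infDist_of_mem_upperSide ⟨x, hx⟩ hpos hy
  have h2 := infDist_le_dist_of_mem (x := y) hx'
  have hkk : k' ≤ k + 2 := by
    by_contra! hcon
    have h3 := dyadicScale_antitone hN.pos (show k + 3 ≤ k' by omega)
    rw [dyadicScale_succ, dyadicScale_succ, dyadicScale_succ] at h3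
    linarith [hy'.1]
  have hd : dist x' x ≤ dyadicScale r₀ k / 2 := by
    linarith [dist_triangle_left x' x y, hy.1, hy'.1]
  have h4 := (abs_le.1 (hfa.abs_inner_le x' hx' (by linarith))).2
  have h5 := inner_le_add_norm_sub (y - x') a b
  have h6 : y - x' = (y - x) - (x' - x) := by abel
  have h7 : inner ℝ (y - x') a = inner ℝ (y - x) a - inner ℝ (x' - x) a := by
    rw [h6, inner_sub_left]
  have h8 := hy'.2
  have h9 := hy'.1
  rw [dist_eq_norm] at h9
  rw [inner_neg_right] at h8
  have h10 : ‖y - x'‖ * ‖a - b‖ ≤ dyadicScale r₀ k / 4 * (1 / 5) :=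
    mul_le_mul (by linarith) (hab hd hkk) (norm_nonneg _) (by linarith)
  linarith [hy.2]

/-- Near a point of `E` there is a function separating the sides of `E`. -/
theorem exists_separatesAt_near (hN : IsFlatSystem E r₀ N) {x₀ : X} (hx₀ : x₀ ∈ E) :
    ∃ f : X → Bool, ∀ y ∈ ball x₀ (r₀ / 5), SeparatesAt E r₀ N f y := by
  classical
  have hr₀ := hN.pos
  choose! M hM hM₀ hMs using fun x (hx : x ∈ E ∧ dist x x₀ ≤ r₀ / 2) =>
    hN.exists_coherent_signs hx.1 hx₀ hx.2
  have hnear : ∀ k x x', (x ∈ E ∧ dist x x₀ ≤ r₀ / 2) → (x' ∈ E ∧ dist x' x₀ ≤ r₀ / 2) →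
      dist x' x ≤ dyadicScale r₀ k / 2 → ‖M x k - M x' k‖ ≤ 1 / 10 := by
    intro k x x' hx hx' hd
    refine (hN.isFlatNormal_of hx.1 (hM x hx k)).norm_sub_le_of_norm_sub_lt_one
      (hN.isFlatNormal_of hx'.1 (hM x' hx' k)) hx'.1 (hN.scale_pos k) le_rfl
      (by linarith [hN.scale_pos k]) hd ?_
    induction k with
    | zero =>
      have h1 := norm_sub_le_norm_sub_add_norm_sub (M x 0) (N x₀ 0) (M x' 0)
      rw [norm_sub_rev (M x 0) (N x₀ 0)] at h1
      linarith [hM₀ x hx, hM₀ x' hx']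
    | succ k ih =>
      have hd' : dist x' x ≤ dyadicScale r₀ k / 2 := by
        rw [dyadicScale_succ] at hd; linarith [hN.scale_pos k]
      have h0 := (hN.isFlatNormal_of hx.1 (hM x hx k)).norm_sub_le_of_norm_sub_lt_one
        (hN.isFlatNormal_of hx'.1 (hM x' hx' k)) hx'.1 (hN.scale_pos k) le_rfl
        (by linarith [hN.scale_pos k]) hd' (ih hd')
      have h1 := norm_sub_le_norm_sub_add_norm_sub (M x (k + 1)) (M x k) (M x' (k + 1))
      have h2 := norm_sub_le_norm_sub_add_norm_sub (M x k) (M x' k) (M x' (k + 1))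
      rw [norm_sub_rev (M x (k + 1)) (M x k)] at h1
      linarith [hMs x hx k, hMs x' hx' k]
  have hvert : ∀ x, (x ∈ E ∧ dist x x₀ ≤ r₀ / 2) → ∀ k k', k ≤ k' → k' ≤ k + 2 →
      ‖M x k - M x k'‖ ≤ 1 / 10 := by
    intro x hx k k' hk hk'
    obtain rfl | rfl | rfl : k' = k ∨ k' = k + 1 ∨ k' = k + 2 := by omega
    · rw [sub_self, norm_zero]; norm_num
    · exact hMs x hx k
    · have hpos := hN.scale_pos k
      refine (hN.isFlatNormal_of hx.1 (hM x hx k)).norm_sub_le_of_norm_sub_lt_one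
        (hN.isFlatNormal_of hx.1 (hM x hx (k + 2))) hx.1 (hN.scale_pos _)
        (dyadicScale_antitone hN.pos hk)
        (by rw [dyadicScale_succ, dyadicScale_succ]; linarith)
        (by rw [dist_self]; linarith) ?_
      linarith [norm_sub_le_norm_sub_add_norm_sub (M x k) (M x (k + 1)) (M x (k + 2)),
        hMs x hx k, hMs x hx (k + 1)]
  have hclose : ∀ x x', (x ∈ E ∧ dist x x₀ ≤ r₀ / 2) → (x' ∈ E ∧ dist x' x₀ ≤ r₀ / 2) →
      ∀ k k', k ≤ k' → dist x' x ≤ dyadicScale r₀ k / 2 → k' ≤ k + 2 →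
      ‖M x k - M x' k'‖ ≤ 1 / 5 := by
    intro x x' hx hx' k k' hk hd hk'
    linarith [norm_sub_le_norm_sub_add_norm_sub (M x k) (M x' k) (M x' k'),
      hnear k x x' hx hx' hd, hvert x' hx' k k' hk hk']
  let P : Set X := {y | ∃ x k, (x ∈ E ∧ dist x x₀ ≤ r₀ / 2) ∧
    y ∈ upperSide x (M x k) (dyadicScale r₀ k)}
  have hneg : ∀ y x k, (x ∈ E ∧ dist x x₀ ≤ r₀ / 2) →
      y ∈ upperSide x (-M x k) (dyadicScale r₀ k) → y ∉ P := by
    rintro y x' k' hx' hy' ⟨x, k, hx, hy⟩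
    rcases le_total k k' with hk | hk
    · exact hN.false_of_mem_upperSide_neg hx.1 hx'.1 (hM x hx k) hk
        (hclose x x' hx hx' k k' hk) hy hy'
    · refine hN.false_of_mem_upperSide_neg (b := -M x k) hx'.1 hx.1
        (by rcases hM x' hx' k' with h | h <;> simp [h]) hk (fun hd hkk => ?_) hy'
        (by rwa [neg_neg])
      rw [neg_sub_neg, norm_sub_rev]
      exact hclose x' x hx' hx k' k hk hd hkk
  refine ⟨fun y => decide (y ∈ P), fun z hz => ⟨fun hzE => ?_, fun hzE => ?_⟩⟩
  · obtain ⟨x, hx, hxz⟩ := hN.isCompact.exists_infDist_eq_dist ⟨x₀, hx₀⟩ z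
    rw [mem_ball] at hz
    have hzx : dist z x ≤ dist z x₀ := hxz ▸ infDist_le_dist_of_mem hx₀
    have hxS : x ∈ E ∧ dist x x₀ ≤ r₀ / 2 := ⟨hx, by linarith [dist_triangle_left x x₀ z]⟩
    obtain ⟨k, -, hk1, hk2⟩ := exists_dyadicScale_near (δ := dist z x) (K := 0) hN.pos
      (dist_pos.2 fun h => hzE (h ▸ hx)) (by rw [dyadicScale_zero]; linarith)
    rw [ContinuousAt, nhds_discrete Bool, Filter.tendsto_pure]
    rcases (hN.isFlatNormal_of hx (hM x hxS k)).mem_upperSide_or hxz.symm hk1.le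
      (by linarith [hN.scale_pos k]) with h | h
    · filter_upwards [(isOpen_upperSide _ _ _).mem_nhds h] with w hw
      have h1 : w ∈ P := ⟨x, k, hxS, hw⟩
      have h2 : z ∈ P := ⟨x, k, hxS, h⟩
      simp [h1, h2]
    · filter_upwards [(isOpen_upperSide _ _ _).mem_nhds h] with w hw
      simp [hneg w x k hxS hw, hneg z x k hxS h]
  · refine ⟨2, fun x hx hd k _ y hy y' hy' => ?_⟩
    have hxS : x ∈ E ∧ dist x x₀ ≤ r₀ / 2 := by
      rw [mem_ball] at hz
      rw [dyadicScale_succ, dyadicScale_succ, dyadicScale_zero] at hd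
      exact ⟨hx, by linarith [dist_triangle x z x₀]⟩
    rcases hM x hxS k with h | h
    · have h1 : y ∈ P := ⟨x, k, hxS, by rwa [h]⟩
      have h2 : y' ∉ P := hneg y' x k hxS (by rwa [h])
      simp [h1, h2]
    · have h1 : y' ∈ P := ⟨x, k, hxS, by rwa [h]⟩
      have h2 : y ∉ P := hneg y x k hxS (by rwa [h, neg_neg])
      simp [h1, h2]

theorem exists_separatesAt_ball (hN : IsFlatSystem E r₀ N) (x : X) :
    ∃ r > 0, ∃ f : X → Bool, ∀ y ∈ ball x r, SeparatesAt E r₀ N f y := by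
  by_cases hx : x ∈ E
  · exact ⟨r₀ / 5, by linarith [hN.pos], hN.exists_separatesAt_near hx⟩
  · obtain ⟨r, hr, hball⟩ := Metric.isOpen_iff.1 hN.isCompact.isClosed.isOpen_compl x hx
    exact ⟨r, hr, fun _ => true, fun y hy =>
      ⟨fun _ => continuousAt_const, fun hyE => absurd hyE (hball hy)⟩⟩

/-- Along a segment issued from `p`, a separating function can be continued from `p`. -/
theorem exists_separatesAt_thickening (hN : IsFlatSystem E r₀ N) {p : X} (hp : p ∉ E) (y : X) :
    ∃ r > 0, ∃ f : X → Bool,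
      (∀ w ∈ thickening r (AffineMap.lineMap p y '' Icc (0 : ℝ) 1), SeparatesAt E r₀ N f w) ∧
        f p = true := by
  classical
  let Q : ℝ → Prop := fun t => ∃ r > 0, ∃ f : X → Bool,
    (∀ w ∈ thickening r (AffineMap.lineMap p y '' Icc (0 : ℝ) t), SeparatesAt E r₀ N f w) ∧
      f p = true
  have hQ0 : Q 0 := by
    obtain ⟨r, hr, hball⟩ := Metric.isOpen_iff.1 hN.isCompact.isClosed.isOpen_compl p hp
    refine ⟨r, hr, fun _ => true, fun w hw => ?_, rfl⟩
    rw [Icc_self, image_singleton, AffineMap.lineMap_apply_zero, thickening_singleton] at hw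
    exact ⟨fun _ => continuousAt_const, fun hwE => absurd hwE (hball hw)⟩
  have hstep : ∀ t ∈ Icc (0 : ℝ) 1, ∃ U ∈ 𝓝 t, ∀ a ∈ U ∩ Icc 0 1, ∀ b ∈ U ∩ Icc 0 1,
      Q a → Q b := by
    intro t _
    obtain ⟨ρ, hρ, g, hg⟩ := hN.exists_separatesAt_ball (AffineMap.lineMap p y t)
    have hcont : Continuous fun s : ℝ => (AffineMap.lineMap p y s : X) :=
      AffineMap.lineMap_continuous
    obtain ⟨δ, hδ, hδ'⟩ := Metric.continuousAt_iff.1 hcont.continuousAt (ρ / 2) (half_pos hρ)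
    refine ⟨ball t δ, ball_mem_nhds t hδ, ?_⟩
    rintro a ⟨ha, ha0, -⟩ b ⟨hb, -⟩ ⟨r, hr, f, hf, hfp⟩
    obtain ⟨h, hh, hhf⟩ := hN.exists_glue isOpen_thickening isOpen_ball
      ((((convex_Icc (0 : ℝ) a).affine_image _).thickening r).inter
        (convex_ball _ _)).isPreconnected hf hg
    refine ⟨min r (ρ / 2), lt_min hr (half_pos hρ), h, fun w hw => hh w ?_, ?_⟩
    · obtain ⟨_, ⟨u, ⟨hu0, hub⟩, rfl⟩, hwu⟩ := mem_thickening_iff.1 hw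
      rw [lt_min_iff] at hwu
      rcases le_or_gt u a with hua | hua
      · exact .inl (mem_thickening_iff.2 ⟨_, ⟨u, ⟨hu0, hua⟩, rfl⟩, hwu.1⟩)
      · refine .inr ?_
        have hut : dist u t < δ := by
          rw [mem_ball, Real.dist_eq, abs_lt] at *
          constructor <;> linarith
        rw [mem_ball]
        linarith [dist_triangle w (AffineMap.lineMap p y u) (AffineMap.lineMap p y t), hδ' hut]
    · rw [hhf p (mem_thickening_iff.2 ⟨p, ⟨0, ⟨le_rfl, ha0⟩, by simp⟩, by simpa using hr⟩), hfp]
  have hcont : ContinuousOn (fun t => decide (Q t)) (Icc 0 1) := fun t ht => by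
    obtain ⟨U, hU, hUQ⟩ := hstep t ht
    rw [ContinuousWithinAt, nhds_discrete Bool, Filter.tendsto_pure]
    filter_upwards [mem_nhdsWithin_of_mem_nhds hU, self_mem_nhdsWithin] with s hs hs1
    have htU : t ∈ U ∩ Icc 0 1 := ⟨mem_of_mem_nhds hU, ht⟩
    exact decide_eq_decide.2 ⟨hUQ s ⟨hs, hs1⟩ t htU, hUQ t htU s ⟨hs, hs1⟩⟩
  have h01 := isPreconnected_Icc.constant hcont (x := 0) (y := 1) (by simp) (by simp)
  exact (decide_eq_decide.1 h01).1 hQ0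

/-- There is a global function separating the sides of `E`. -/
theorem exists_separatesAt (hN : IsFlatSystem E r₀ N) {p : X} (hp : p ∉ E) :
    ∃ F : X → Bool, ∀ y, SeparatesAt E r₀ N F y := by
  choose r hr f hf hfp using hN.exists_separatesAt_thickening hp
  let T : X → Set X := fun y => thickening (r y) (AffineMap.lineMap p y '' Icc (0 : ℝ) 1)
  have hTy : ∀ y, y ∈ T y := fun y =>
    self_subset_thickening (hr y) _ ⟨1, by simp, by simp⟩
  have hTp : ∀ y, p ∈ T y := fun y =>
    self_subset_thickening (hr y) _ ⟨0, by simp, by simp⟩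
  have hTc : ∀ y, Convex ℝ (T y) := fun y => ((convex_Icc 0 1).affine_image _).thickening _
  refine ⟨fun y => f y y, fun y => hN.separatesAt_congr (hf y y (hTy y)) ?_⟩
  filter_upwards [isOpen_thickening.mem_nhds (hTy y)] with w hw hwE
  obtain ⟨c, hc⟩ := hN.exists_xor_eq (isOpen_thickening.inter isOpen_thickening)
    ((hTc w).inter (hTc y)).isPreconnected (fun u hu => hf w u hu.1) (fun u hu => hf y u hu.2)
  have h1 := hc p ⟨hTp w, hTp y⟩ hp
  have h2 := hc w ⟨hTy w, hw⟩ hwE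
  rw [hfp, hfp] at h1
  rw [← h1] at h2
  simpa using h2

theorem isConnected_setOf_eq_true (hN : IsFlatSystem E r₀ N) (hE : IsConnected E)
    (hf : ∀ y, SeparatesAt E r₀ N f y) :
    IsConnected {y | y ∉ E ∧ f y = true} := by
  obtain ⟨z₀, hz₀⟩ := hE.nonempty
  refine ⟨(hN.frequently_eq (hf z₀) hz₀ true).exists, ?_⟩
  refine isPreconnected_of_forall_constant fun g hg => ?_
  choose! c hc using fun z (hz : z ∈ E) => hN.exists_eventually_eq (V := univ) (z := z)
    (fun y _ => hf y) (hg.mono fun y hy => hy.2) Filter.univ_mem hz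
  have hcc : ContinuousOn c E := fun z hz => by
    rw [ContinuousWithinAt, nhds_discrete Bool, Filter.tendsto_pure]
    filter_upwards [mem_nhdsWithin_of_mem_nhds (hc z hz).eventually_nhds,
      self_mem_nhdsWithin] with w hw hwE
    obtain ⟨y, ⟨hyE, hy⟩, h1, h2⟩ :=
      ((hN.frequently_eq (hf w) hwE true).and_eventually (hw.and (hc w hwE))).exists
    exact (h2 hyE hy).symm.trans (h1 hyE hy)
  have key : ∀ y ∈ {y | y ∉ E ∧ f y = true}, g y = c z₀ := by
    rintro y ⟨hyE, hfy⟩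
    obtain ⟨x, hx, hxy⟩ := hN.isCompact.exists_infDist_eq_dist ⟨z₀, hz₀⟩ y
    have hpos : 0 < dist y x := dist_pos.2 fun h => hyE (h ▸ hx)
    have hcont : Continuous fun s : ℝ => (AffineMap.lineMap x y s : X) :=
      AffineMap.lineMap_continuous
    have hdist : ∀ s ∈ Ioc (0 : ℝ) 1, AffineMap.lineMap x y s ∉ E := fun s hs hsE => by
      have h1 := infDist_le_dist_of_mem (x := y) hsE
      rw [hxy, dist_right_lineMap, Real.norm_eq_abs, abs_of_nonneg (by linarith [hs.2]),
        dist_comm x y] at h1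
      nlinarith [hs.1]
    have hfs : ∀ s ∈ Ioc (0 : ℝ) 1, f (AffineMap.lineMap x y s) = true := fun s hs => by
      have hfc : ContinuousOn (fun s : ℝ => f (AffineMap.lineMap x y s)) (Ioc 0 1) := fun u hu =>
        (((hf _).1 (hdist u hu)).comp hcont.continuousAt).continuousWithinAt
      have := isPreconnected_Ioc.constant hfc hs (y := 1) (by simp)
      simpa [hfy] using this
    have hgs : ∀ s ∈ Ioc (0 : ℝ) 1, g (AffineMap.lineMap x y s) = g y := fun s hs => by
      have hgc : ContinuousOn (fun s : ℝ => g (AffineMap.lineMap x y s)) (Ioc 0 1) :=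
        hg.comp hcont.continuousOn fun u hu => ⟨hdist u hu, hfs u hu⟩
      simpa using isPreconnected_Ioc.constant hgc hs (y := 1) (by simp)
    have htend : Filter.Tendsto (fun s : ℝ => (AffineMap.lineMap x y s : X)) (𝓝[>] 0) (𝓝 x) := by
      have := hcont.tendsto 0
      rw [AffineMap.lineMap_apply_zero] at this
      exact this.mono_left nhdsWithin_le_nhds
    obtain ⟨s, h1, h2⟩ := ((htend.eventually (hc x hx)).and
      (Ioc_mem_nhdsGT (zero_lt_one' ℝ))).exists
    rw [← hgs s h2, h1 (hdist s h2) (hfs s h2)]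
    exact hE.isPreconnected.constant hcc hx hz₀
  intro x hx y hy
  rw [key x hx, key y hy]

/-- The complement of a connected set with a flat system of normals has two components. -/
theorem exists_isConnected_compl (hN : IsFlatSystem E r₀ N) (hE : IsConnected E) :
    ∃ U₁ U₂ : Set X, IsOpen U₁ ∧ IsOpen U₂ ∧ IsConnected U₁ ∧ IsConnected U₂ ∧
      Disjoint U₁ U₂ ∧ U₁ ∪ U₂ = Eᶜ := by
  obtain ⟨z, hz⟩ := hE.nonempty
  have hp := hN.notMem_of_mem_upperSide hz (.inl rfl)
    (add_smul_mem_upperSide (hN.scale_pos 0) (hN.isFlatNormal z hz 0).norm_eq_one)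
  obtain ⟨f, hf⟩ := hN.exists_separatesAt hp
  have hopen : ∀ c, IsOpen {y | y ∉ E ∧ f y = c} := fun c => by
    refine ContinuousOn.isOpen_inter_preimage (s := Eᶜ) (t := {c}) (fun y hy => ?_)
      hN.isCompact.isClosed.isOpen_compl (isOpen_discrete _)
    exact ((hf y).1 hy).continuousWithinAt
  have h2 := hN.isConnected_setOf_eq_true hE fun y => (hf y).not
  simp only [Bool.not_eq_true'] at h2
  refine ⟨_, _, hopen true, hopen false, hN.isConnected_setOf_eq_true hE hf, h2, ?_, ?_⟩
  · rw [Set.disjoint_left]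
    rintro y ⟨-, h⟩ ⟨-, h'⟩
    exact absurd (h.symm.trans h') (by decide)
  · ext y
    cases h : f y <;> simp [h]

end IsFlatSystem
end Existence

section LocDist

variable {n : ℕ} {x : EuclideanSpace ℝ (Fin n)} {r ε : ℝ} {A B : Set (EuclideanSpace ℝ (Fin n))}

theorem locDist_comm : locDist x r A B = locDist x r B A := add_comm _ _

theorem infDist_le_of_locDist_le (hx : x ∈ B) (hr : 0 < r) (h : locDist x r A B ≤ ε)
    {y : EuclideanSpace ℝ (Fin n)} (hy : y ∈ A) (hyx : dist y x ≤ r) :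
    infDist y B ≤ r * ε := by
  have hbdd : BddAbove ((fun y => infDist y B) '' (A ∩ closedBall x r)) := by
    refine ⟨r, ?_⟩
    rintro _ ⟨w, ⟨-, hw⟩, rfl⟩
    exact (infDist_le_dist_of_mem hx).trans hw
  have h1 := le_csSup hbdd ⟨y, ⟨hy, hyx⟩, rfl⟩
  have h2 : 0 ≤ sSup ((fun y => infDist y A) '' (B ∩ closedBall x r)) := by
    refine Real.sSup_nonneg ?_
    rintro _ ⟨w, -, rfl⟩
    exact infDist_nonneg
  have h3 : r⁻¹ * infDist y B ≤ ε := by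
    refine le_trans ?_ h
    have := mul_le_mul_of_nonneg_left h1 (inv_nonneg.2 hr.le)
    have := mul_nonneg (inv_nonneg.2 hr.le) h2
    unfold locDist
    linarith
  rwa [inv_mul_le_iff₀ hr] at h3

theorem exists_unit_normal {P : Submodule ℝ (EuclideanSpace ℝ (Fin n))} (hn : 1 ≤ n)
    (hP : Module.finrank ℝ P = n - 1) :
    ∃ v : EuclideanSpace ℝ (Fin n), ‖v‖ = 1 ∧ ∀ w, w ∈ P ↔ inner ℝ w v = 0 := by
  have h1 : Module.finrank ℝ Pᗮ = 1 := by
    have := P.finrank_add_finrank_orthogonal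
    rw [hP, finrank_euclideanSpace_fin] at this
    omega
  obtain ⟨⟨u, hu⟩, hu0, hspan⟩ := finrank_eq_one_iff'.1 h1
  have hu0' : u ≠ 0 := fun h => hu0 (Subtype.ext h)
  have hun : ‖u‖ ≠ 0 := norm_ne_zero_iff.2 hu0'
  refine ⟨‖u‖⁻¹ • u, by rw [norm_smul, norm_inv, norm_norm, inv_mul_cancel₀ hun], fun w => ?_⟩
  rw [real_inner_smul_right, mul_eq_zero, or_iff_right (inv_ne_zero hun)]
  constructor
  · intro hw
    exact P.inner_right_of_mem_orthogonal hw hu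
  · intro hw
    rw [← P.orthogonal_orthogonal, Submodule.mem_orthogonal]
    intro t ht
    obtain ⟨c, hc⟩ := hspan ⟨t, ht⟩
    have hc : c • u = t := congrArg Subtype.val hc
    rw [← hc, real_inner_smul_left, real_inner_comm, hw, mul_zero]

theorem exists_isFlatNormal {P : AffineSubspace ℝ (EuclideanSpace ℝ (Fin n))} (hn : 1 ≤ n)
    (hA : IsCompact A) (hxA : x ∈ A) (hr : 0 < r) (hxP : x ∈ P)
    (hP : Module.finrank ℝ P.direction = n - 1) (hε : ε ≤ 1 / 10000)
    (h : locDist x r A P ≤ ε) : ∃ v, IsFlatNormal A x r v := by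
  obtain ⟨v, hv, hmem⟩ := exists_unit_normal hn hP
  have hrε : r * ε ≤ r / 10000 := by nlinarith
  refine ⟨v, hv, fun y hy hyx => ?_, fun y hyx hy => ?_⟩
  · refine le_trans ?_ ((infDist_le_of_locDist_le hxP hr h hy hyx).trans hrε)
    refine (le_infDist ⟨x, hxP⟩).2 fun w hw => ?_
    have h1 := (hmem _).1 (AffineSubspace.vsub_mem_direction hw hxP)
    rw [vsub_eq_sub] at h1
    have h2 : y - x = (y - w) + (w - x) := by abel
    rw [h2, inner_add_left, h1, add_zero, dist_eq_norm]
    simpa [hv] using abs_real_inner_le_norm (y - w) v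
  · have hyP : y ∈ P := by
      have := AffineSubspace.vadd_mem_of_mem_direction ((hmem _).2 hy) hxP
      rwa [vadd_eq_add, sub_add_cancel] at this
    obtain ⟨z, hz, hyz⟩ := hA.exists_infDist_eq_dist ⟨x, hxA⟩ y
    exact ⟨z, hz, hyz ▸
      (infDist_le_of_locDist_le hxA hr (locDist_comm.trans_le h) hyP hyx).trans hrε⟩

end LocDist

/-- Separation (part of Theorem 1.18): in codimension 1, there is an `ε₂ > 0` depending
only on `n` such that if `E ⊂ ℝⁿ` is a nonempty compact connected set with
`γ(x,r) ≤ ε < ε₂` for all `x ∈ E` and `0 < r ≤ r₀`, then `ℝⁿ \ E` has exactly two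
connected components. -/
theorem stmt16 (n : ℕ) (hn : 2 ≤ n) :
    ∃ ε₂ : ℝ, 0 < ε₂ ∧
      ∀ E : Set (EuclideanSpace ℝ (Fin n)), IsCompact E → IsConnected E →
      ∀ r₀ ε : ℝ, 0 < r₀ → 0 < ε → ε < ε₂ →
      (∀ x ∈ E, ∀ r : ℝ, 0 < r → r ≤ r₀ →
        ∃ P : AffineSubspace ℝ (EuclideanSpace ℝ (Fin n)),
          x ∈ P ∧ Module.finrank ℝ P.direction = n - 1 ∧
          locDist x r E (P : Set (EuclideanSpace ℝ (Fin n))) ≤ ε) →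
      ∃ U₁ U₂ : Set (EuclideanSpace ℝ (Fin n)),
        IsOpen U₁ ∧ IsOpen U₂ ∧ IsConnected U₁ ∧ IsConnected U₂ ∧
        Disjoint U₁ U₂ ∧ U₁ ∪ U₂ = Eᶜ := by
  refine ⟨1 / 10000, by norm_num, fun E hE hconn r₀ ε hr₀ _ hε hflat => ?_⟩
  have hex : ∀ x ∈ E, ∀ k, ∃ v, IsFlatNormal E x (dyadicScale r₀ k) v := fun x hx k => by
    obtain ⟨P, hxP, hP, hd⟩ := hflat x hx _ (dyadicScale_pos hr₀ k)
      ((dyadicScale_antitone hr₀ (Nat.zero_le k)).trans_eq (dyadicScale_zero r₀))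
    exact exists_isFlatNormal (by omega) hE hx (dyadicScale_pos hr₀ k) hxP hP hε.le hd
  choose! N hN using hex
  exact IsFlatSystem.exists_isConnected_compl ⟨hE, hr₀, hN⟩ hconn
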